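/- arXiv:0709.2174 — 2 statements merged into one kernel-verified Lean document; each statement's English description precedes it below -/
import Mathlib

section
/- If G is a finitely generated group of polynomial growth, then the commutator subgroup [G, G] is also finitely generated. -/
open scoped BigOperators

/-- The ball of radius `n` in a group `G` with respect to a set `S`:
elements expressible as a product of at most `n` elements of `S`. -/
def ball {G : Type*} [Group G] (S : Set G) (n : ℕ) : Set G :=
  {g | ∃ l : List G, (∀ x ∈ l, x ∈ S) ∧ l.length ≤ n ∧ l.prod = g}

/-- The growth function of `G` relative to `S`: `γ_S(n) = |B_S(n)|`. -/
noncomputable def growth {G : Type*} [Group G] (S : Set G) (n : ℕ) : ℕ := (ball S n).ncard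

/-- A finite symmetric generating set of `G`. -/
def IsSymmGen {G : Type*} [Group G] (S : Finset G) : Prop :=
  (∀ x ∈ S, x⁻¹ ∈ S) ∧ Subgroup.closure (S : Set G) = ⊤

/-- `G` has polynomial growth: for some finite symmetric generating set `S`
there are `C > 0` and `k : ℕ` with `γ_S(n) ≤ C * n ^ k` for all `n ≥ 1`. -/
def HasPolyGrowth (G : Type*) [Group G] : Prop :=
  ∃ S : Finset G, IsSymmGen S ∧ ∃ C : ℝ, 0 < C ∧ ∃ k : ℕ,
    ∀ n : ℕ, 1 ≤ n → (growth (S : Set G) n : ℝ) ≤ C * (n : ℝ) ^ k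

lemma ball_finite {G : Type*} [Group G] (S : Finset G) (n : ℕ) : (ball (S : Set G) n).Finite := by
  refine ((List.finite_length_le (↥S) n).image fun l => (l.map Subtype.val).prod).subset ?_
  rintro g ⟨l, hS, hn, rfl⟩
  lift l to List S using hS
  exact ⟨l, by simpa using hn, rfl⟩

lemma one_mem_ball {G : Type*} [Group G] (S : Set G) (n : ℕ) : (1 : G) ∈ ball S n :=
  ⟨[], by simp, by simp, rfl⟩

lemma mul_mem_ball {G : Type*} [Group G] {S : Set G} {m n : ℕ} {g h : G}
    (hg : g ∈ ball S m) (hh : h ∈ ball S n) : g * h ∈ ball S (m + n) := by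
  obtain ⟨l, hl, hlm, rfl⟩ := hg
  obtain ⟨l', hl', hln, rfl⟩ := hh
  refine ⟨l ++ l', ?_, by simp; omega, by simp⟩
  intro x hx
  rcases List.mem_append.1 hx with h | h
  exacts [hl x h, hl' x h]

lemma ball_mono {G : Type*} [Group G] (S : Set G) : Monotone (ball S) := by
  rintro m n hmn g ⟨l, hl, hlm, rfl⟩
  exact ⟨l, hl, hlm.trans hmn, rfl⟩

lemma IsSymmGen.exists_mem_ball {G : Type*} [Group G] {S : Finset G} (hS : IsSymmGen S) (g : G) :
    ∃ n, g ∈ ball (S : Set G) n := by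
  have hg : g ∈ Subgroup.closure (S : Set G) := hS.2 ▸ Subgroup.mem_top g
  induction hg using Subgroup.closure_induction'' with
  | mem x hx => exact ⟨1, [x], by simpa using hx, by simp, by simp⟩
  | inv_mem x hx => exact ⟨1, [x⁻¹], by simpa using hS.1 x hx, by simp, by simp⟩
  | one => exact ⟨0, one_mem_ball _ _⟩
  | mul x y _ _ hx hy =>
    obtain ⟨m, hm⟩ := hx
    obtain ⟨n, hn⟩ := hy
    exact ⟨m + n, mul_mem_ball hm hn⟩

/-- The product `x ^ e₀ * a * x ^ e₁ * a * ⋯`, where each exponent `eᵢ` is `0` or `1`. -/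
def binaryWord {G : Type*} [Group G] (a x : G) : List Bool → G
  | [] => 1
  | e :: l => cond e x 1 * a * binaryWord a x l

lemma binaryWord_mem_ball {G : Type*} [Group G] {S : Set G} {a x : G} {L : ℕ}
    (ha : a ∈ ball S L) (hxa : x * a ∈ ball S L) (l : List Bool) :
    binaryWord a x l ∈ ball S (L * l.length) := by
  induction l with
  | nil => exact one_mem_ball _ _
  | cons e l ih =>
    rw [List.length_cons, mul_add, mul_one, add_comm]
    refine mul_mem_ball ?_ ih
    cases e <;> simpa

lemma exists_pow_lt_two_pow (C : ℝ) (k L : ℕ) (hC : 0 < C) (hL : 1 ≤ L) :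
    ∃ m : ℕ, 1 ≤ m ∧ C * ((L * m : ℕ) : ℝ) ^ k < 2 ^ m := by
  have hpos : 0 < C * (L : ℝ) ^ k := by positivity
  have h := tendsto_pow_const_div_const_pow_of_one_lt k (one_lt_two : (1 : ℝ) < 2)
  obtain ⟨m, hm, hm1⟩ := ((h.eventually_lt_const (inv_pos.2 hpos)).and
    (Filter.eventually_ge_atTop 1)).exists
  refine ⟨m, hm1, ?_⟩
  rw [div_lt_iff₀ (by positivity), inv_mul_eq_div, lt_div_iff₀ hpos] at hm
  push_cast
  rw [mul_pow]
  linarith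

lemma HasPolyGrowth.exists_binaryWord_eq {G : Type*} [Group G] (h : HasPolyGrowth G) (a x : G) :
    ∃ l l' : List Bool, l.length = l'.length ∧ l ≠ l' ∧
      binaryWord a x l = binaryWord a x l' := by
  obtain ⟨S, hS, C, hC, k, hk⟩ := h
  obtain ⟨p, hp⟩ := hS.exists_mem_ball a
  obtain ⟨q, hq⟩ := hS.exists_mem_ball (x * a)
  obtain ⟨m, hm, hlt⟩ := exists_pow_lt_two_pow C k (p + q + 1) hC (by omega)
  by_contra! hinj
  have hf : Function.Injective fun v : List.Vector Bool m => binaryWord a x v.1 := by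
    intro v w hvw
    by_contra hne
    exact hinj v.1 w.1 (v.2.trans w.2.symm) (fun h => hne (Subtype.ext h)) hvw
  have hcard : 2 ^ m ≤ growth (S : Set G) ((p + q + 1) * m) := by
    have hsub : Set.range (fun v : List.Vector Bool m => binaryWord a x v.1) ⊆
        ball (S : Set G) ((p + q + 1) * m) := by
      rintro _ ⟨v, rfl⟩
      have := binaryWord_mem_ball (ball_mono _ (show p ≤ p + q + 1 by omega) hp)
        (ball_mono _ (show q ≤ p + q + 1 by omega) hq) v.1
      rwa [v.2] at this
    have := Set.ncard_le_ncard hsub (ball_finite S _)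
    rwa [← Nat.card_coe_set_eq, Nat.card_range_of_injective hf, Nat.card_eq_fintype_card,
      card_vector, Fintype.card_bool] at this
  have h1 := hk ((p + q + 1) * m) (by nlinarith)
  have h2 : (2 : ℝ) ^ m ≤ growth (S : Set G) ((p + q + 1) * m) := by exact_mod_cast hcard
  linarith

/-- The subgroup generated by the conjugates of `x` by `a, a ^ 2, …, a ^ r`. -/
def conjSpan {G : Type*} [Group G] (a x : G) (r : ℕ) : Subgroup G :=
  Subgroup.closure ((fun i : ℕ => a ^ i * x * (a ^ i)⁻¹) '' Set.Icc 1 r)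

lemma conjSpan_fg {G : Type*} [Group G] (a x : G) (r : ℕ) : (conjSpan a x r).FG :=
  Subgroup.fg_iff _ |>.2 ⟨_, rfl, (Set.finite_Icc 1 r).image _⟩

lemma conj_mem_conjSpan {G : Type*} [Group G] (a x : G) {r i : ℕ} (h1 : 1 ≤ i) (hr : i ≤ r) :
    a ^ i * x * (a ^ i)⁻¹ ∈ conjSpan a x r :=
  Subgroup.subset_closure ⟨i, ⟨h1, hr⟩, rfl⟩

lemma conj_mem_conjSpan_succ {G : Type*} [Group G] (a x : G) (r : ℕ) {g : G}
    (hg : g ∈ conjSpan a x r) : a * g * a⁻¹ ∈ conjSpan a x (r + 1) := by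
  suffices conjSpan a x r ≤ (conjSpan a x (r + 1)).comap (MulAut.conj a).toMonoidHom from this hg
  refine (Subgroup.closure_le _).2 ?_
  rintro _ ⟨i, ⟨h1, hr⟩, rfl⟩
  have := conj_mem_conjSpan a x (show 1 ≤ i + 1 by omega) (show i + 1 ≤ r + 1 by omega)
  simpa [pow_succ', mul_assoc] using this

lemma binaryWord_mul_inv_pow_mem {G : Type*} [Group G] (a x : G) (l : List Bool) :
    a * (binaryWord a x l * (a ^ l.length)⁻¹) * a⁻¹ ∈ conjSpan a x l.length := by
  induction l with
  | nil => simp [binaryWord, one_mem]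
  | cons e l ih =>
    have h1 := conj_mem_conjSpan_succ a x l.length ih
    have h2 : a * cond e x 1 * a⁻¹ ∈ conjSpan a x (l.length + 1) := by
      cases e
      · simp [one_mem]
      · simpa using conj_mem_conjSpan a x le_rfl (show 1 ≤ l.length + 1 by omega)
    rw [List.length_cons]
    convert mul_mem h2 h1 using 1
    simp only [binaryWord, pow_succ']
    group

lemma mem_conjSpan_of_binaryWord_eq {G : Type*} [Group G] (a x : G) (l l' : List Bool)
    (hlen : l.length = l'.length) (hne : l ≠ l') (h : binaryWord a x l = binaryWord a x l') :
    ∃ r, x ∈ conjSpan a x r := by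
  induction l generalizing l' with
  | nil => exact absurd (List.eq_nil_of_length_eq_zero hlen.symm).symm hne
  | cons e l ih =>
    match l', hlen, hne, h with
    | e' :: l', hlen, hne, h =>
    replace hlen : l.length = l'.length := by simpa using hlen
    by_cases he : e = e'
    · subst he
      exact ih l' hlen (fun h' => hne (h' ▸ rfl)) (mul_left_cancel h)
    · refine ⟨l.length, ?_⟩
      have h1 := binaryWord_mul_inv_pow_mem a x l
      have h2 := binaryWord_mul_inv_pow_mem a x l'
      rw [← hlen] at h2
      have h3 := mul_mem h1 (inv_mem h2)
      have h4 := inv_mem h3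
      cases e <;> cases e' <;> simp [binaryWord] at he h
      · rw [eq_comm, ← eq_mul_inv_iff_mul_eq, ← eq_mul_inv_iff_mul_eq] at h
        convert h3 using 1
        refine h.trans ?_
        group
      · rw [← eq_mul_inv_iff_mul_eq, ← eq_mul_inv_iff_mul_eq] at h
        convert h4 using 1
        refine h.trans ?_
        group

lemma inv_pow_conj_mem_conjSpan {G : Type*} [Group G] {a x : G} {r : ℕ}
    (hx : x ∈ conjSpan a x r) (n : ℕ) : (a ^ n)⁻¹ * x * a ^ n ∈ conjSpan a x r := by
  have hle : conjSpan a x r ≤ (conjSpan a x r).comap (MulAut.conj a⁻¹).toMonoidHom := by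
    refine (Subgroup.closure_le _).2 ?_
    rintro _ ⟨i, ⟨h1, hr⟩, rfl⟩
    obtain ⟨i, rfl⟩ : ∃ j, i = j + 1 := ⟨i - 1, by omega⟩
    have key : a ^ i * x * (a ^ i)⁻¹ ∈ conjSpan a x r := by
      rcases Nat.eq_zero_or_pos i with rfl | hi
      · simpa using hx
      · exact conj_mem_conjSpan a x hi (by omega)
    simpa [pow_succ', mul_assoc] using key
  induction n with
  | zero => simpa using hx
  | succ n ih =>
    have := hle ih
    simpa [pow_succ, mul_assoc] using this

lemma HasPolyGrowth.exists_mem_conjSpan {G : Type*} [Group G] (h : HasPolyGrowth G) (a x : G) :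
    ∃ r, x ∈ conjSpan a x r := by
  obtain ⟨l, l', hlen, hne, heq⟩ := h.exists_binaryWord_eq a x
  exact mem_conjSpan_of_binaryWord_eq a x l l' hlen hne heq

/-- **Milnor's lemma**: in a group of polynomial growth, the conjugates of `x` by the powers of `a`
generate a finitely generated subgroup. -/
lemma HasPolyGrowth.fg_closure_conj {G : Type*} [Group G] (h : HasPolyGrowth G) (a x : G) :
    (Subgroup.closure (Set.range fun n : ℤ => a ^ n * x * (a ^ n)⁻¹)).FG := by
  obtain ⟨r, hr⟩ := h.exists_mem_conjSpan a x
  obtain ⟨s, hs⟩ := h.exists_mem_conjSpan a⁻¹ x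
  convert (conjSpan_fg a x r).sup (conjSpan_fg a⁻¹ x s) using 1
  refine le_antisymm ((Subgroup.closure_le _).2 ?_) (sup_le ?_ ?_)
  · rintro _ ⟨n, rfl⟩
    obtain ⟨n, rfl | rfl⟩ := n.eq_nat_or_neg
    · exact Subgroup.mem_sup_right (by simpa using inv_pow_conj_mem_conjSpan hs n)
    · exact Subgroup.mem_sup_left (by simpa using inv_pow_conj_mem_conjSpan hr n)
  · refine Subgroup.closure_mono ?_
    rintro _ ⟨i, -, rfl⟩
    exact ⟨i, by simp⟩
  · refine Subgroup.closure_mono ?_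
    rintro _ ⟨i, -, rfl⟩
    exact ⟨-i, by simp⟩

lemma HasPolyGrowth.fg_of_fg_sup_zpowers {G : Type*} [Group G] (h : HasPolyGrowth G)
    (H : Subgroup G) [H.Normal] (a : G) (hfg : (H ⊔ Subgroup.zpowers a).FG) : H.FG := by
  obtain ⟨T, hT⟩ := hfg
  have hdec : ∀ t ∈ T, ∃ y ∈ H, ∃ z ∈ Subgroup.zpowers a, y * z = t := fun t ht =>
    Subgroup.mem_sup_of_normal_left.1 (hT ▸ Subgroup.subset_closure ht)
  choose! y hy z hz hyz using hdec
  let K : Subgroup G :=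
    ⨆ t ∈ T, Subgroup.closure (Set.range fun n : ℤ => a ^ n * y t * (a ^ n)⁻¹)
  have hKfg : K.FG := Subgroup.FG.biSup_finset T _ fun t _ => h.fg_closure_conj a (y t)
  have hmem : ∀ t ∈ T, ∀ n : ℤ, a ^ n * y t * (a ^ n)⁻¹ ∈ K := fun t ht n =>
    Subgroup.mem_iSup_of_mem t (Subgroup.mem_iSup_of_mem ht (Subgroup.subset_closure ⟨n, rfl⟩))
  have hKH : K ≤ H := iSup₂_le fun t ht => (Subgroup.closure_le _).2 <| by
    rintro _ ⟨n, rfl⟩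
    exact Subgroup.Normal.conj_mem ‹_› _ (hy t ht) _
  have hconj : ∀ m : ℤ, ∀ g ∈ K, a ^ m * g * (a ^ m)⁻¹ ∈ K := by
    intro m
    suffices K ≤ K.comap (MulAut.conj (a ^ m)).toMonoidHom from fun g hg => this hg
    refine iSup₂_le fun t ht => (Subgroup.closure_le _).2 ?_
    rintro _ ⟨n, rfl⟩
    have := hmem t ht (m + n)
    simpa [-map_zpow, zpow_add, mul_assoc] using this
  have hnorm : Subgroup.zpowers a ≤ Subgroup.normalizer (K : Set G) := by
    rintro _ ⟨m, rfl⟩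
    refine Subgroup.mem_normalizer_iff.2 fun g => ⟨hconj m g, fun hg => ?_⟩
    have := hconj (-m) _ hg
    simpa [mul_assoc] using this
  have hle : H ≤ K ⊔ Subgroup.zpowers a := by
    refine le_sup_left.trans (hT.symm.le.trans ((Subgroup.closure_le _).2 fun t ht => ?_))
    rw [← hyz t ht]
    exact mul_mem (Subgroup.mem_sup_left (by simpa using hmem t ht 0))
      (Subgroup.mem_sup_right (hz t ht))
  have hH : H = K ⊔ (H ⊓ Subgroup.zpowers a) := by
    refine le_antisymm (fun g hg => ?_) (sup_le hKH inf_le_left)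
    have hg' : g ∈ ((K ⊔ Subgroup.zpowers a : Subgroup G) : Set G) := hle hg
    rw [Subgroup.coe_mul_of_right_le_normalizer_left _ _ hnorm] at hg'
    obtain ⟨u, hu, v, hv, rfl⟩ := hg'
    exact mul_mem (Subgroup.mem_sup_left hu) (Subgroup.mem_sup_right
      ⟨(Subgroup.mul_mem_cancel_left H (hKH hu)).1 hg, hv⟩)
  rw [hH]
  refine hKfg.sup ?_
  obtain ⟨b, hb⟩ := (Subgroup.isCyclic_iff_exists_zpowers_eq_top (H ⊓ Subgroup.zpowers a)).1
    (Subgroup.isCyclic_of_le inf_le_right)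
  rw [← hb]
  exact ⟨{b}, by simp [Subgroup.zpowers_eq_closure]⟩

lemma HasPolyGrowth.fg_commutator_of_fg_sup_closure {G : Type*} [Group G] (h : HasPolyGrowth G)
    (T : Finset G) (hT : (commutator G ⊔ Subgroup.closure (T : Set G)).FG) :
    (commutator G).FG := by
  classical
  induction T using Finset.induction_on with
  | empty => simpa using hT
  | insert a T _ ih =>
    have : (commutator G ⊔ Subgroup.closure (T : Set G)).Normal :=
      Subgroup.Normal.of_commutator_le _ le_sup_left
    refine ih (h.fg_of_fg_sup_zpowers _ a ?_)
    rwa [Finset.coe_insert, Set.insert_eq, Subgroup.closure_union, ← Subgroup.zpowers_eq_closure,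
      sup_comm (Subgroup.zpowers a), ← sup_assoc] at hT

/-- If `G` is a finitely generated group of polynomial growth, then the commutator
subgroup `[G, G]` is also finitely generated. -/
theorem stmt0 {G : Type*} [Group G] (h : HasPolyGrowth G) :
    (commutator G).FG := by
  obtain ⟨S, hS, -⟩ := id h
  refine h.fg_commutator_of_fg_sup_closure S ?_
  rw [hS.2, sup_top_eq]
  exact ⟨S, hS.2⟩
end

section
/- For all natural numbers m and n, the number of lattice points x = (x_1, …, x_m) ∈ ℤ^m with |x_1| + |x_2| + ⋯ + |x_m| ≤ n equals ∑_{l=0}^{m} 2^l · C(m, l) · C(n, l), where C(a, b) denotes the binomial coefficient. Equivalently, this sum is the value γ(n) of the growth function of the free abelian group ℤ^m with respect to the symmetric generating set consisting of the standard basis vectors and their negatives. -/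
open scoped BigOperators

/-- The ball of radius `n` in an additive group with respect to a set `S`. -/
def addBall {A : Type*} [AddGroup A] (S : Set A) (n : ℕ) : Set A :=
  {g | ∃ l : List A, (∀ x ∈ l, x ∈ S) ∧ l.length ≤ n ∧ l.sum = g}

/-- The lattice points of `ℤ^m` of `ℓ¹`-norm at most `n`. -/
def crossPolytope (m n : ℕ) : Set (Fin m → ℤ) :=
  {x | (∑ i, |x i|) ≤ (n : ℤ)}

theorem finite_crossPolytope (m n : ℕ) : (crossPolytope m n).Finite := by
  refine (Set.finite_Icc (fun _ : Fin m => -(n : ℤ)) (fun _ => (n : ℤ))).subset fun x hx => ?_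
  have h (i : Fin m) : |x i| ≤ n :=
    (Finset.single_le_sum (fun j _ => abs_nonneg (x j)) (Finset.mem_univ i)).trans hx
  exact ⟨fun i => (abs_le.mp (h i)).1, fun i => (abs_le.mp (h i)).2⟩

theorem mem_crossPolytope_succ {m n : ℕ} {x : Fin (m + 1) → ℤ} :
    x ∈ crossPolytope (m + 1) n ↔ |x 0| + ∑ i : Fin m, |x i.succ| ≤ n := by
  rw [crossPolytope, Set.mem_ofPred_eq, Fin.sum_univ_succ]

theorem ncard_crossPolytope_inter_zero (m n : ℕ) :
    (crossPolytope (m + 1) n ∩ {x | x 0 = 0}).ncard = (crossPolytope m n).ncard := by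
  rw [← Set.ncard_image_of_injective (crossPolytope m n)
    (Fin.cons_right_injective (α := fun _ : Fin (m + 1) => ℤ) 0)]
  congr 1
  ext x
  simp only [Set.mem_inter_iff, mem_crossPolytope_succ, Set.mem_ofPred_eq, Set.mem_image]
  constructor
  · rintro ⟨h, h0⟩
    refine ⟨Fin.tail x, ?_, ?_⟩
    · simpa [h0, crossPolytope, Fin.tail] using h
    · rw [← h0, Fin.cons_self_tail]
  · rintro ⟨y, hy, rfl⟩
    simpa [crossPolytope] using hy

theorem ncard_crossPolytope_inter_pos (m n : ℕ) :
    (crossPolytope (m + 1) (n + 1) ∩ {x | 0 < x 0}).ncard =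
      (crossPolytope (m + 1) n ∩ {x | 0 ≤ x 0}).ncard := by
  rw [← Set.ncard_image_of_injective (crossPolytope (m + 1) n ∩ {x | 0 ≤ x 0})
    (add_left_injective (Pi.single 0 1 : Fin (m + 1) → ℤ))]
  congr 1
  ext x
  simp only [Set.mem_inter_iff, mem_crossPolytope_succ, Set.mem_ofPred_eq, Set.mem_image]
  constructor
  · rintro ⟨h, h0⟩
    refine ⟨x - Pi.single 0 1, ⟨?_, ?_⟩, sub_add_cancel _ _⟩
    · simp only [Pi.sub_apply, Pi.single_eq_same, Pi.single_eq_of_ne (Fin.succ_ne_zero _), sub_zero]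
      rw [abs_of_pos h0] at h
      rw [abs_of_nonneg (by lia)]
      push_cast at h
      lia
    · simp only [Pi.sub_apply, Pi.single_eq_same]
      lia
  · rintro ⟨y, ⟨h, h0⟩, rfl⟩
    simp only [Pi.add_apply, Pi.single_eq_same, Pi.single_eq_of_ne (Fin.succ_ne_zero _), add_zero]
    rw [abs_of_nonneg h0] at h
    rw [abs_of_nonneg (by lia)]
    push_cast
    lia

theorem ncard_crossPolytope_inter_neg (m n : ℕ) (p : ℤ → Prop) (i : Fin m) :
    (crossPolytope m n ∩ {x | p (-x i)}).ncard =
      (crossPolytope m n ∩ {x | p (x i)}).ncard := by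
  rw [← Set.ncard_image_of_injective (crossPolytope m n ∩ {x | p (x i)}) neg_injective]
  congr 1
  ext x
  simp [crossPolytope]

theorem ncard_crossPolytope_succ_succ (m n : ℕ) :
    (crossPolytope (m + 1) (n + 1)).ncard = (crossPolytope m (n + 1)).ncard +
      (crossPolytope (m + 1) n).ncard + (crossPolytope m n).ncard := by
  have hneg := ncard_crossPolytope_inter_neg (m + 1) (n + 1) (0 < ·) 0
  have hnonpos := ncard_crossPolytope_inter_neg (m + 1) n (0 ≤ ·) 0
  have hpos := ncard_crossPolytope_inter_pos m n
  have hzero := ncard_crossPolytope_inter_zero m (n + 1)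
  have hzero' := ncard_crossPolytope_inter_zero m n
  have hfin (a b : ℕ) (s) : (crossPolytope a b ∩ s).Finite :=
    (finite_crossPolytope a b).inter_of_left s
  have hsplit : (crossPolytope (m + 1) (n + 1)).ncard =
      (crossPolytope (m + 1) (n + 1) ∩ {x | x 0 = 0}).ncard +
      ((crossPolytope (m + 1) (n + 1) ∩ {x | 0 < x 0}).ncard +
      (crossPolytope (m + 1) (n + 1) ∩ {x | 0 < -x 0}).ncard) := by
    rw [← Set.ncard_union_eq _ (hfin _ _ _) (hfin _ _ _),
      ← Set.ncard_union_eq _ (hfin _ _ _) ((hfin _ _ _).union (hfin _ _ _))]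
    · congr 1
      ext x
      simp only [Set.mem_union, Set.mem_inter_iff, Set.mem_ofPred_eq]
      grind
    · rw [Set.disjoint_left]
      simp only [Set.mem_union, Set.mem_inter_iff, Set.mem_ofPred_eq]
      grind
    · rw [Set.disjoint_left]
      simp only [Set.mem_inter_iff, Set.mem_ofPred_eq]
      grind
  have hcover := Set.ncard_union_add_ncard_inter
    (crossPolytope (m + 1) n ∩ {x | 0 ≤ x 0}) (crossPolytope (m + 1) n ∩ {x | 0 ≤ -x 0})
    (hfin _ _ _) (hfin _ _ _)
  have hunion : crossPolytope (m + 1) n ∩ {x | 0 ≤ x 0} ∪ crossPolytope (m + 1) n ∩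
      {x | 0 ≤ -x 0} = crossPolytope (m + 1) n := by
    ext x
    simp only [Set.mem_union, Set.mem_inter_iff, Set.mem_ofPred_eq]
    grind
  have hinter : crossPolytope (m + 1) n ∩ {x | 0 ≤ x 0} ∩ (crossPolytope (m + 1) n ∩
      {x | 0 ≤ -x 0}) = crossPolytope (m + 1) n ∩ {x | x 0 = 0} := by
    ext x
    simp only [Set.mem_inter_iff, Set.mem_ofPred_eq]
    grind
  rw [hunion, hinter] at hcover
  lia

/-- The sum `∑ 2^l C(m,l) C(n,l)`, known as the Delannoy number of `m` and `n`. -/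
def delannoySum (m n : ℕ) : ℕ :=
  ∑ l ∈ Finset.range (m + 1), 2 ^ l * m.choose l * n.choose l

theorem delannoySum_succ_left (m n : ℕ) :
    delannoySum (m + 1) n = delannoySum m n +
      ∑ l ∈ Finset.range (m + 1), 2 ^ (l + 1) * m.choose l * n.choose (l + 1) := by
  have h : delannoySum m n =
      ∑ l ∈ Finset.range (m + 2), 2 ^ l * m.choose l * n.choose l := by
    rw [Finset.sum_range_succ, Nat.choose_succ_self]
    simp [delannoySum]
  rw [h, delannoySum, Finset.sum_range_succ', Finset.sum_range_succ' _ (m + 1),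
    add_right_comm, ← Finset.sum_add_distrib]
  congr 1
  · refine Finset.sum_congr rfl fun l _ => ?_
    rw [Nat.choose_succ_succ]
    ring
  · simp

theorem delannoySum_succ_succ (m n : ℕ) :
    delannoySum (m + 1) (n + 1) =
      delannoySum m (n + 1) + delannoySum (m + 1) n + delannoySum m n := by
  have h : ∑ l ∈ Finset.range (m + 1), 2 ^ (l + 1) * m.choose l * (n + 1).choose (l + 1) =
      2 * delannoySum m n +
        ∑ l ∈ Finset.range (m + 1), 2 ^ (l + 1) * m.choose l * n.choose (l + 1) := by
    rw [delannoySum, Finset.mul_sum, ← Finset.sum_add_distrib]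
    refine Finset.sum_congr rfl fun l _ => ?_
    rw [Nat.choose_succ_succ n]
    ring
  rw [delannoySum_succ_left m (n + 1), delannoySum_succ_left m n, h]
  ring

theorem crossPolytope_radius_zero (m : ℕ) : crossPolytope m 0 = {0} := by
  ext x
  rw [crossPolytope, Set.mem_ofPred_eq, Nat.cast_zero, Set.mem_singleton_iff]
  constructor
  · intro h
    have h0 := h.antisymm (Finset.sum_nonneg fun i _ => abs_nonneg (x i))
    rw [Finset.sum_eq_zero_iff_of_nonneg fun i _ => abs_nonneg (x i)] at h0
    exact funext fun i => abs_eq_zero.mp (h0 i (Finset.mem_univ i))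
  · rintro rfl
    simp

theorem ncard_crossPolytope (m n : ℕ) : (crossPolytope m n).ncard = delannoySum m n := by
  induction m generalizing n with
  | zero =>
    have h : crossPolytope 0 n = {0} := by
      ext x
      simp [crossPolytope, Subsingleton.elim x 0]
    simp [h, delannoySum]
  | succ m ihm =>
    induction n with
    | zero => simp [crossPolytope_radius_zero, delannoySum, Finset.sum_range_succ']
    | succ n ihn =>
      rw [ncard_crossPolytope_succ_succ, delannoySum_succ_succ, ihm, ihm, ihn]

theorem exists_single_sum_abs_sub_add_one {m : ℕ} {x : Fin m → ℤ} (hx : x ≠ 0) :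
    ∃ v : Fin m → ℤ, (∃ i, v = Pi.single i 1 ∨ v = -Pi.single i 1) ∧
      ∑ j, |(x - v) j| + 1 = ∑ j, |x j| := by
  obtain ⟨i, hi⟩ := Function.ne_iff.mp hx
  rw [Pi.zero_apply] at hi
  obtain ⟨v, hv, hvi, hvj⟩ : ∃ v : Fin m → ℤ, (v = Pi.single i 1 ∨ v = -Pi.single i 1) ∧
      |x i - v i| + 1 = |x i| ∧ ∀ j ≠ i, v j = 0 := by
    rcases lt_or_gt_of_ne hi with h | h
    · refine ⟨_, Or.inr rfl, ?_, fun j hj => by simp [hj]⟩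
      rw [Pi.neg_apply, Pi.single_eq_same]
      grind
    · refine ⟨_, Or.inl rfl, ?_, fun j hj => by simp [hj]⟩
      rw [Pi.single_eq_same]
      grind
  refine ⟨v, ⟨i, hv⟩, ?_⟩
  rw [← Finset.add_sum_erase _ _ (Finset.mem_univ i),
    ← Finset.add_sum_erase _ (fun j => |x j|) (Finset.mem_univ i), ← hvi, Pi.sub_apply,
    Finset.sum_congr rfl fun j hj => by
      rw [Pi.sub_apply, hvj j (Finset.ne_of_mem_erase hj), sub_zero]]
  ring

theorem addBall_single_eq_crossPolytope (m n : ℕ) :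
    addBall {v : Fin m → ℤ | ∃ i, v = Pi.single i 1 ∨ v = -Pi.single i 1} n =
      crossPolytope m n := by
  ext x
  constructor
  · rintro ⟨l, hl, hn, rfl⟩
    refine le_trans ?_ (Int.ofNat_le.mpr hn)
    clear hn
    induction l with
    | nil => simp
    | cons v l ih =>
      obtain ⟨⟨i, hv⟩, hl⟩ := List.forall_mem_cons.mp hl
      have hv1 : ∑ j, |v j| = 1 := by
        have (j : Fin m) : |v j| = (Pi.single i 1 : Fin m → ℤ) j := by
          rcases hv with rfl | rfl <;> by_cases h : j = i <;> simp [h]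
        simp [this]
      calc ∑ j, |(v :: l).sum j| ≤ ∑ j, (|v j| + |l.sum j|) := by
            refine Finset.sum_le_sum fun j _ => ?_
            rw [List.sum_cons, Pi.add_apply]
            exact abs_add_le _ _
        _ ≤ ((v :: l).length : ℤ) := by
            rw [Finset.sum_add_distrib, hv1, List.length_cons]
            push_cast
            linarith [ih hl]
  · intro hx
    induction n generalizing x with
    | zero =>
      rw [crossPolytope_radius_zero, Set.mem_singleton_iff] at hx
      exact ⟨[], by simp, by simp, by simp [hx]⟩
    | succ n ih =>
      by_cases h0 : x = 0
      · exact ⟨[], by simp, by simp, by simp [h0]⟩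
      obtain ⟨v, hv, hsum⟩ := exists_single_sum_abs_sub_add_one h0
      rw [crossPolytope, Set.mem_ofPred_eq, ← hsum, Nat.cast_succ] at hx
      obtain ⟨l, hl, hn, hlx⟩ := ih (x - v) (by simpa [crossPolytope] using hx)
      refine ⟨v :: l, List.forall_mem_cons.mpr ⟨hv, hl⟩, by simpa using hn, ?_⟩
      rw [List.sum_cons, hlx, add_sub_cancel]

/-- The number of lattice points `x ∈ ℤ^m` with `∑ |x i| ≤ n` equals
`∑_{l=0}^{m} 2^l * C(m,l) * C(n,l)`; equivalently, this is the value of the growth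
function of `ℤ^m` with respect to the standard basis vectors and their negatives. -/
theorem stmt3 (m n : ℕ) :
    ({x : Fin m → ℤ | (∑ i, |x i|) ≤ (n : ℤ)}).ncard
        = ∑ l ∈ Finset.range (m + 1), 2 ^ l * m.choose l * n.choose l ∧
    (addBall {v : Fin m → ℤ | ∃ i, v = Pi.single i 1 ∨ v = -Pi.single i 1} n).ncard
        = ∑ l ∈ Finset.range (m + 1), 2 ^ l * m.choose l * n.choose l := by
  rw [addBall_single_eq_crossPolytope]
  exact ⟨ncard_crossPolytope m n, ncard_crossPolytope m n⟩
end
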